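/- Let R be a Noetherian local ring and A a graded Noetherian R-algebra with A_0 = R, and let x ∈ A_1 be a nonzerodivisor on A. Suppose that for all j with 1 ≤ j ≤ s, the R-module A_j/xA_{j−1} is torsion-free. Then for a rank-one situation where A = R(E) is the Rees algebra of a module E with x ∈ E, the natural surjection A/(x) → R(E/Rx) is an isomorphism in degrees ≤ s; in particular E^j/xE^{j−1} ≅ (E/Rx)^j for 1 ≤ j ≤ s. -/

import Mathlib

set_option maxHeartbeats 1000000
set_option synthInstance.maxHeartbeats 400000

open scoped TensorProduct

noncomputable section

universe u

section Defs
variable (R : Type u) [CommRing R]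

/-- The total ring of fractions of `R`. -/
abbrev TotalQuot := Localization (nonZeroDivisors R)

/-- `E` has rank `e`: `E ⊗_R Quot(R)` is free of rank `e` over the total quotient ring. -/
def HasRank (E : Type u) [AddCommGroup E] [Module R E] (e : ℕ) : Prop :=
  Nonempty ((TotalQuot R ⊗[R] E) ≃ₗ[TotalQuot R] (Fin e → TotalQuot R))

/-- Complement of a prime ideal, with the primality hypothesis explicit. -/
def primeCompl' (p : Ideal R) (hp : p.IsPrime) : Submonoid R :=
  @Ideal.primeCompl R _ p hp

/-- Minimal number of generators of a module. -/
def minGens (E : Type u) [AddCommGroup E] [Module R E] : ℕ :=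
  sInf {n | ∃ f : Fin n → E, Submodule.span R (Set.range f) = ⊤}

/-- The grade of an ideal `I` on a module `M`: supremum of lengths of
`M`-regular sequences contained in `I`. -/
def sequenceGrade (I : Ideal R) (M : Type u) [AddCommGroup M] [Module R M] : ℕ∞ :=
  sSup {n : ℕ∞ | ∃ rs : List R, (rs.length : ℕ∞) = n ∧ (∀ r ∈ rs, r ∈ I) ∧
    RingTheory.Sequence.IsRegular M rs}

/-- Depth of a module over a local ring. -/
def moduleDepth [IsLocalRing R] (M : Type u) [AddCommGroup M] [Module R M] : ℕ∞ :=
  sequenceGrade R (IsLocalRing.maximalIdeal R) M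

/-- The grade of a module: grade of its annihilator on `R`. -/
def moduleGrade (M : Type u) [AddCommGroup M] [Module R M] : ℕ∞ :=
  sequenceGrade R (Module.annihilator R M) R

/-- Dimension of a module: Krull dimension of `R` modulo the annihilator. -/
def moduleDim (M : Type u) [AddCommGroup M] [Module R M] : WithBot ℕ∞ :=
  ringKrullDim (R ⧸ Module.annihilator R M)

/-- Krull dimension of the localization `R_p`. -/
def localDimAt (p : Ideal R) (hp : p.IsPrime) : WithBot ℕ∞ :=
  ringKrullDim (Localization (primeCompl' R p hp))

/-- Height of an ideal: infimum of `dim R_p` over primes `p ⊇ I`. -/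
def idealHeight (I : Ideal R) : WithBot ℕ∞ :=
  sInf {d | ∃ (p : Ideal R) (hp : p.IsPrime), I ≤ p ∧ d = localDimAt R p hp}

/-- A local ring is Cohen-Macaulay if its depth equals its dimension. -/
def IsCMLocalRing [IsLocalRing R] : Prop :=
  (moduleDepth R R : WithBot ℕ∞) = ringKrullDim R

/-- A ring is Cohen-Macaulay if all its localizations at maximal ideals are. -/
def IsCMRing : Prop :=
  ∀ (p : Ideal R), ∀ hp : p.IsMaximal,
    letI : p.IsPrime := hp.isPrime
    (moduleDepth (Localization.AtPrime p) (Localization.AtPrime p) : WithBot ℕ∞)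
      = ringKrullDim (Localization.AtPrime p)

/-- A finite module over a local ring is Cohen-Macaulay if it is zero or
its depth equals its dimension. -/
def IsCMModule [IsLocalRing R] (M : Type u) [AddCommGroup M] [Module R M] : Prop :=
  Subsingleton M ∨ (moduleDepth R M : WithBot ℕ∞) = moduleDim R M

open CategoryTheory in
/-- Vanishing of `Ext_R^n(M, N)`. -/
def extVanish (M N : Type u) [AddCommGroup M] [Module R M] [AddCommGroup N] [Module R N]
    (n : ℕ) : Prop :=
  Subsingleton (((Ext R (ModuleCat.{u} R) n).obj (Opposite.op (ModuleCat.of R M))).obj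
    (ModuleCat.of R N))

/-- A Noetherian local ring is Gorenstein iff it is Cohen-Macaulay and `R` has finite
injective dimension, i.e. `Ext^i(k, R) = 0` for all large `i`. -/
def IsGorensteinLocalRing [IsLocalRing R] : Prop :=
  IsCMLocalRing R ∧ ∃ n : ℕ, ∀ i : ℕ, n < i → extVanish R (IsLocalRing.ResidueField R) R i

variable (E : Type u) [AddCommGroup E] [Module R E]

/-- Defining relations of the symmetric algebra, presented as the free commutative
`R`-algebra on `E` modulo linearity relations. -/
def symRels : Set (MvPolynomial E R) :=
  {p | ∃ x y : E, p = MvPolynomial.X (x + y) - MvPolynomial.X x - MvPolynomial.X y} ∪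
  {p | ∃ (r : R) (x : E), p = MvPolynomial.X (r • x) - MvPolynomial.C r * MvPolynomial.X x}

/-- The symmetric algebra of a module. -/
abbrev SymModAlg := MvPolynomial E R ⧸ Ideal.span (symRels R E)

/-- The `R`-torsion ideal of an `R`-algebra `A`. -/
def torsionIdeal (A : Type u) [CommRing A] [Algebra R A] : Ideal A where
  carrier := {a | ∃ r ∈ nonZeroDivisors R, r • a = 0}
  zero_mem' := ⟨1, one_mem _, smul_zero _⟩
  add_mem' := by
    rintro a b ⟨r, hr, ha⟩ ⟨s, hs, hb⟩
    refine ⟨r * s, mul_mem hr hs, ?_⟩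
    have h1 : (r * s) • a = 0 := by rw [mul_comm, mul_smul, ha, smul_zero]
    have h2 : (r * s) • b = 0 := by rw [mul_smul, hb, smul_zero]
    rw [smul_add, h1, h2, add_zero]
  smul_mem' := by
    rintro c a ⟨r, hr, ha⟩
    exact ⟨r, hr, by rw [smul_comm, ha, smul_zero]⟩

/-- The Rees algebra of a module: the symmetric algebra modulo `R`-torsion. -/
abbrev ReesModAlg := SymModAlg R E ⧸ torsionIdeal R (SymModAlg R E)

/-- The canonical map `E → R(E)`. -/
def reesι (x : E) : ReesModAlg R E :=
  Ideal.Quotient.mk _ (Ideal.Quotient.mk _ (MvPolynomial.X x))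

/-- The `j`-th power `E^j` of a module: the `j`-th graded component of its Rees
algebra, i.e. the `R`-span of products of `j` elements of `E`. -/
def reesPower (j : ℕ) : Submodule R (ReesModAlg R E) :=
  Submodule.span R {a | ∃ f : Fin j → E, a = ∏ i, reesι R E (f i)}

/-- A module is of linear type if its symmetric algebra is `R`-torsion-free,
i.e. the natural surjection `S(E) → R(E)` is an isomorphism. -/
def IsLinearType : Prop := torsionIdeal R (SymModAlg R E) = ⊥

/-- The extension of the maximal ideal to the Rees algebra. -/
def fiberIdeal [IsLocalRing R] : Ideal (ReesModAlg R E) :=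
  Ideal.map (algebraMap R (ReesModAlg R E)) (IsLocalRing.maximalIdeal R)

/-- The analytic spread: Krull dimension of the special fiber ring `R(E) ⊗ k`. -/
def analyticSpread [IsLocalRing R] : WithBot ℕ∞ :=
  ringKrullDim (ReesModAlg R E ⧸ fiberIdeal R E)

/-- The submodule `U·E^r` of the Rees algebra. -/
def mulPower (U : Submodule R E) (r : ℕ) : Submodule R (ReesModAlg R E) :=
  Submodule.span R {a | ∃ u ∈ U, ∃ f : Fin r → E, a = reesι R E u * ∏ i, reesι R E (f i)}

/-- `U` is a reduction of `E` if `E^{r+1} = U·E^r` for some `r`. -/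
def IsReduction (U : Submodule R E) : Prop :=
  ∃ r : ℕ, reesPower R E (r + 1) = mulPower R E U r

/-- A minimal reduction. -/
def IsMinimalReduction (U : Submodule R E) : Prop :=
  IsReduction R E U ∧ ∀ U' : Submodule R E, U' ≤ U → IsReduction R E U' → U' = U

/-- The reduction number of a reduction `U`. -/
def reductionNumberOf (U : Submodule R E) : ℕ :=
  sInf {r | reesPower R E (r + 1) = mulPower R E U r}

/-- The reduction number of `E`. -/
def reductionNumber : ℕ :=
  sInf {r | ∃ U : Submodule R E, IsMinimalReduction R E U ∧ reductionNumberOf R E U = r}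

/-- The condition `G_s` for a module of rank `e`:
`μ(E_p) ≤ dim R_p + e - 1` for all primes with `1 ≤ dim R_p ≤ s - 1`. -/
def Gcond (e s : ℕ) : Prop :=
  ∀ (p : Ideal R) (hp : p.IsPrime),
    (1 : WithBot ℕ∞) ≤ localDimAt R p hp → localDimAt R p hp + 1 ≤ (s : WithBot ℕ∞) →
    (minGens (Localization (primeCompl' R p hp)) (LocalizedModule (primeCompl' R p hp) E)
        : WithBot ℕ∞) ≤ localDimAt R p hp + ((e - 1 : ℕ) : WithBot ℕ∞)

/-- The condition `G_∞` for a module of rank `e`. -/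
def GcondInf (e : ℕ) : Prop := ∀ s : ℕ, Gcond R E e s

/-- The condition `G_s` for an ideal: `μ(I_p) ≤ dim R_p` for all primes `p ⊇ I`
with `dim R_p ≤ s - 1`. -/
def GcondIdeal (I : Ideal R) (s : ℕ) : Prop :=
  ∀ (p : Ideal R) (hp : p.IsPrime), I ≤ p → localDimAt R p hp + 1 ≤ (s : WithBot ℕ∞) →
    (minGens (Localization (primeCompl' R p hp)) (LocalizedModule (primeCompl' R p hp) ↥I)
        : WithBot ℕ∞) ≤ localDimAt R p hp

/-- The `0`-th Fitting ideal of a module. -/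
def fitting0 (M : Type u) [AddCommGroup M] [Module R M] : Ideal R :=
  ⨆ (n : ℕ) (π : (Fin n → R) →ₗ[R] M) (_ : Function.Surjective π),
    Ideal.span {d | ∃ A : Matrix (Fin n) (Fin n) R,
      (∀ jc : Fin n, π (fun i => A i jc) = 0) ∧ d = A.det}

end Defs
/-- The submodule `x·E^r` of the Rees algebra of `E`. -/
def xMulPow (R : Type u) [CommRing R] (E : Type u) [AddCommGroup E] [Module R E]
    (x : E) (r : ℕ) : Submodule R (ReesModAlg R E) :=
  Submodule.span R {b | ∃ c ∈ reesPower R E r, b = reesι R E x * c}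

/-- The quotient `E^j / x·E^{j-1}`. -/
abbrev xQuot (R : Type u) [CommRing R] (E : Type u) [AddCommGroup E] [Module R E]
    (x : E) (j : ℕ) :=
  ↥(reesPower R E j) ⧸
    Submodule.comap (reesPower R E j).subtype (xMulPow R E x (j - 1))

section Helpers
variable {R : Type u} [CommRing R] {E : Type u} [AddCommGroup E] [Module R E]

/-- The lift of a linear map to the symmetric algebra. -/
def symLift {A : Type u} [CommRing A] [Algebra R A] (f : E →ₗ[R] A) : SymModAlg R E →ₐ[R] A :=
  Ideal.Quotient.liftₐ _ (MvPolynomial.aeval (fun e => f e)) (by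
    intro a ha
    have h : Ideal.span (symRels R E) ≤
        RingHom.ker (MvPolynomial.aeval (R := R) (fun e => f e)) := by
      rw [Ideal.span_le]
      rintro p (⟨y, z, rfl⟩ | ⟨r, y, rfl⟩)
      · simp [RingHom.mem_ker]
      · simp [RingHom.mem_ker, Algebra.smul_def]
    exact h ha)

theorem symLift_mk {A : Type u} [CommRing A] [Algebra R A] (f : E →ₗ[R] A)
    (p : MvPolynomial E R) :
    symLift f (Ideal.Quotient.mk _ p) = MvPolynomial.aeval (fun e => f e) p := rfl

/-- The lift of a linear map to the Rees algebra, for torsion-free targets. -/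
def reesLift {A : Type u} [CommRing A] [Algebra R A] (f : E →ₗ[R] A)
    (hA : ∀ r ∈ nonZeroDivisors R, ∀ a : A, r • a = 0 → a = 0) : ReesModAlg R E →ₐ[R] A :=
  Ideal.Quotient.liftₐ _ (symLift f) (by
    rintro a ⟨r, hr, h⟩
    exact hA r hr _ (by rw [← map_smul, h, map_zero]))

theorem reesLift_mk {A : Type u} [CommRing A] [Algebra R A] (f : E →ₗ[R] A) (hA)
    (p : SymModAlg R E) :
    reesLift f hA (Ideal.Quotient.mk _ p) = symLift f p := rfl

theorem reesLift_ι {A : Type u} [CommRing A] [Algebra R A] (f : E →ₗ[R] A) (hA) (e : E) :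
    reesLift f hA (reesι R E e) = f e := by
  rw [reesι, reesLift_mk, symLift_mk, MvPolynomial.aeval_X]

theorem rees_torsionFree (r : R) (hr : r ∈ nonZeroDivisors R) (a : ReesModAlg R E)
    (h : r • a = 0) : a = 0 := by
  obtain ⟨a, rfl⟩ := Ideal.Quotient.mk_surjective a
  have h' : (Ideal.Quotient.mk (torsionIdeal R (SymModAlg R E))) (r • a) = 0 := h
  rw [Ideal.Quotient.eq_zero_iff_mem] at h' ⊢
  obtain ⟨t, ht, h2⟩ := h'
  exact ⟨t * r, mul_mem ht hr, by rw [mul_smul, h2]⟩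

variable (R E) in
/-- The canonical linear map to the Rees algebra. -/
def reesL : E →ₗ[R] ReesModAlg R E where
  toFun := reesι R E
  map_add' y z := by
    unfold reesι
    rw [← map_add, ← map_add]
    congr 1
    rw [Ideal.Quotient.eq]
    exact Ideal.subset_span (Or.inl ⟨y, z, by ring⟩)
  map_smul' r y := by
    have : (Ideal.Quotient.mk (Ideal.span (symRels R E))) (MvPolynomial.X (r • y)) =
        Ideal.Quotient.mk _ (MvPolynomial.C r * MvPolynomial.X y) := by
      rw [Ideal.Quotient.eq]
      exact Ideal.subset_span (Or.inr ⟨r, y, rfl⟩)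
    unfold reesι
    rw [this, RingHom.id_apply, Algebra.smul_def, map_mul, map_mul]
    rfl

theorem rees_induction {P : ReesModAlg R E → Prop} (hC : ∀ r : R, P (algebraMap R _ r))
    (hadd : ∀ a b, P a → P b → P (a + b)) (hmul : ∀ a e, P a → P (a * reesι R E e))
    (a : ReesModAlg R E) : P a := by
  obtain ⟨a, rfl⟩ := Ideal.Quotient.mk_surjective a
  obtain ⟨p, rfl⟩ := Ideal.Quotient.mk_surjective a
  induction p using MvPolynomial.induction_on with
  | C r => exact hC r
  | add p q hp hq => rw [map_add, map_add]; exact hadd _ _ hp hq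
  | mul_X p e hp => rw [map_mul, map_mul]; exact hmul _ _ hp

/-- The grading map. -/
def reesTheta (R E : Type u) [CommRing R] [AddCommGroup E] [Module R E] :
    ReesModAlg R E →ₐ[R] Polynomial (ReesModAlg R E) :=
  reesLift
    (((LinearMap.mulRight R (Polynomial.X : Polynomial (ReesModAlg R E))).comp
      (Polynomial.CAlgHom (R := R) (A := ReesModAlg R E)).toLinearMap).comp (reesL R E)) (by
    intro r hr a h
    ext n
    apply rees_torsionFree r hr
    rw [← Polynomial.coeff_smul, h, Polynomial.coeff_zero])

theorem reesTheta_ι (e : E) : reesTheta R E (reesι R E e) =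
    Polynomial.C (reesι R E e) * Polynomial.X := by
  rw [reesTheta, reesLift_ι]; rfl

theorem reesPower_mul_ι {k : ℕ} {a : ReesModAlg R E} (ha : a ∈ reesPower R E k) (e : E) :
    a * reesι R E e ∈ reesPower R E (k + 1) := by
  unfold reesPower at ha
  induction ha using Submodule.span_induction with
  | mem a h =>
    obtain ⟨f, rfl⟩ := h
    exact Submodule.subset_span ⟨Fin.snoc f e, by simp [Fin.prod_univ_castSucc]⟩
  | zero => rw [zero_mul]; exact zero_mem _
  | add a b _ _ h1 h2 => rw [add_mul]; exact add_mem h1 h2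
  | smul r a _ h => rw [smul_mul_assoc]; exact Submodule.smul_mem _ _ h

theorem coeff_reesTheta_mem (a : ReesModAlg R E) :
    ∀ k, (reesTheta R E a).coeff k ∈ reesPower R E k := by
  induction a using rees_induction with
  | hC r =>
    intro k
    rw [AlgHom.commutes, Polynomial.algebraMap_apply, Polynomial.coeff_C]
    split_ifs with h
    · subst h
      rw [Algebra.algebraMap_eq_smul_one]
      exact Submodule.smul_mem _ _ (Submodule.subset_span ⟨Fin.elim0, by simp⟩)
    · exact zero_mem _
  | hadd a b ha hb =>
    intro k
    rw [map_add, Polynomial.coeff_add]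
    exact add_mem (ha k) (hb k)
  | hmul a e ha =>
    intro k
    rw [map_mul, reesTheta_ι, ← mul_assoc]
    cases k with
    | zero => rw [Polynomial.coeff_mul_X_zero]; exact zero_mem _
    | succ k =>
      rw [Polynomial.coeff_mul_X, Polynomial.coeff_mul_C]
      exact reesPower_mul_ι (ha k) e

theorem reesTheta_of_mem {k : ℕ} {a : ReesModAlg R E} (ha : a ∈ reesPower R E k) :
    (reesTheta R E a).coeff k = a := by
  unfold reesPower at ha
  induction ha using Submodule.span_induction with
  | mem a h =>
    obtain ⟨f, rfl⟩ := h
    rw [map_prod]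
    simp only [reesTheta_ι]
    rw [Finset.prod_mul_distrib, ← map_prod, Finset.prod_const, Finset.card_univ,
      Fintype.card_fin, Polynomial.coeff_C_mul, Polynomial.coeff_X_pow_self, mul_one]
  | zero => rw [map_zero, Polynomial.coeff_zero]
  | add a b _ _ h1 h2 => rw [map_add, Polynomial.coeff_add, h1, h2]
  | smul r a _ h => rw [map_smul, Polynomial.coeff_smul, h]

theorem mem_xMulPow {k : ℕ} {x : E} {a : ReesModAlg R E} (ha : a ∈ reesPower R E (k + 1))
    (h : a ∈ Ideal.span {reesι R E x}) : a ∈ xMulPow R E x k := by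
  obtain ⟨c, rfl⟩ := Ideal.mem_span_singleton'.1 h
  have h1 := reesTheta_of_mem ha
  rw [map_mul, reesTheta_ι, ← mul_assoc, Polynomial.coeff_mul_X, Polynomial.coeff_mul_C] at h1
  exact Submodule.subset_span ⟨_, coeff_reesTheta_mem c k, by rw [← h1, mul_comm]⟩

/-- The natural map of Rees algebras. -/
def reesPhi (x : E) : ReesModAlg R E →ₐ[R] ReesModAlg R (E ⧸ Submodule.span R {x}) :=
  reesLift ((reesL R _).comp (Submodule.mkQ _)) rees_torsionFree

theorem reesPhi_ι (x e : E) : reesPhi (R := R) x (reesι R E e) =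
    reesι R _ (Submodule.Quotient.mk e) := by
  rw [reesPhi, reesLift_ι]; rfl

theorem reesPhi_ι_self (x : E) : reesPhi (R := R) x (reesι R E x) = 0 := by
  rw [reesPhi_ι, (Submodule.Quotient.mk_eq_zero _).2 (Submodule.mem_span_singleton_self x)]
  exact (reesL R _).map_zero

theorem reesPhi_ker (x : E) (a : ReesModAlg R E) (h : reesPhi (R := R) x a = 0) :
    ∃ r ∈ nonZeroDivisors R, r • a ∈ Ideal.span {reesι R E x} := by
  obtain ⟨a, rfl⟩ := Ideal.Quotient.mk_surjective a
  obtain ⟨p, rfl⟩ := Ideal.Quotient.mk_surjective a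
  let g : MvPolynomial E R →ₐ[R] SymModAlg R (E ⧸ Submodule.span R {x}) :=
    MvPolynomial.aeval (fun e => Ideal.Quotient.mk _ (MvPolynomial.X (Submodule.Quotient.mk e)))
  let m : SymModAlg R (E ⧸ Submodule.span R {x}) →ₐ[R]
    ReesModAlg R (E ⧸ Submodule.span R {x}) := Ideal.Quotient.mkₐ R _
  have hg : reesPhi (R := R) x (Ideal.Quotient.mk _ (Ideal.Quotient.mk _ p)) = m (g p) := by
    have : ((reesPhi (R := R) x).comp ((Ideal.Quotient.mkₐ R _).comp (Ideal.Quotient.mkₐ R _)))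
        = m.comp g := by
      apply MvPolynomial.algHom_ext
      intro e
      refine (reesPhi_ι x e).trans ?_
      rw [AlgHom.comp_apply, MvPolynomial.aeval_X]
      rfl
    exact DFunLike.congr_fun this p
  rw [hg] at h
  obtain ⟨r, hr, h2⟩ : g p ∈ torsionIdeal R _ := Ideal.Quotient.eq_zero_iff_mem.1 h
  refine ⟨r, hr, ?_⟩
  let q : ReesModAlg R E →ₐ[R] (ReesModAlg R E ⧸ Ideal.span {reesι R E x}) :=
    Ideal.Quotient.mkₐ R _
  let f : (E ⧸ Submodule.span R {x}) →ₗ[R] (ReesModAlg R E ⧸ Ideal.span {reesι R E x}) :=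
    Submodule.liftQ _ (q.toLinearMap.comp (reesL R E)) (by
      rw [Submodule.span_singleton_le_iff_mem, LinearMap.mem_ker]
      exact Ideal.Quotient.eq_zero_iff_mem.2 (Ideal.mem_span_singleton_self _))
  have hf : symLift f (g p) = q (Ideal.Quotient.mk _ (Ideal.Quotient.mk _ p)) := by
    have : (symLift f).comp g =
        q.comp ((Ideal.Quotient.mkₐ R _).comp (Ideal.Quotient.mkₐ R _)) := by
      apply MvPolynomial.algHom_ext
      intro e
      rw [AlgHom.comp_apply, MvPolynomial.aeval_X, symLift_mk, MvPolynomial.aeval_X]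
      rfl
    exact DFunLike.congr_fun this p
  have h3 := congrArg (symLift f) h2
  rw [map_smul, map_zero, hf, ← map_smul] at h3
  exact Ideal.Quotient.eq_zero_iff_mem.1 h3

theorem reesPhi_map (x : E) (j : ℕ) :
    (reesPower R E j).map (reesPhi (R := R) x).toLinearMap = reesPower R _ j := by
  unfold reesPower
  rw [Submodule.map_span]
  congr 1
  ext b
  constructor
  · rintro ⟨_, ⟨f, rfl⟩, rfl⟩
    refine ⟨fun i => Submodule.Quotient.mk (f i), ?_⟩
    rw [AlgHom.toLinearMap_apply, map_prod]
    simp only [reesPhi_ι]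
  · rintro ⟨f, rfl⟩
    choose f' hf' using fun i => Submodule.Quotient.mk_surjective _ (f i)
    refine ⟨_, ⟨f', rfl⟩, ?_⟩
    rw [AlgHom.toLinearMap_apply, map_prod]
    simp only [reesPhi_ι, hf']

end Helpers

/-- If `x ∈ E` is a nonzerodivisor of degree one on `A = R(E)` and the
graded components `A_j/xA_{j-1} = E^j/xE^{j-1}` are torsion-free for `j ≤ s`, then the
natural surjection `A/(x) → R(E/Rx)` is an isomorphism in degrees `≤ s`; in particular
`E^j/xE^{j-1} ≅ (E/Rx)^j` for `1 ≤ j ≤ s`. -/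
theorem statement_17 (R : Type u) [CommRing R] [IsLocalRing R] [IsNoetherianRing R]
    (E : Type u) [AddCommGroup E] [Module R E] [Module.Finite R E]
    (x : E) (s : ℕ)
    (hreg : IsSMulRegular (ReesModAlg R E) (reesι R E x))
    (htf : ∀ j : ℕ, 1 ≤ j → j ≤ s → Submodule.torsion R (xQuot R E x j) = ⊥) :
    ∀ j : ℕ, 1 ≤ j → j ≤ s →
      Nonempty ((xQuot R E x j) ≃ₗ[R]
        ↥(reesPower R (E ⧸ Submodule.span R {x}) j)) := by
  intro j hj hjs
  obtain ⟨k, rfl⟩ : ∃ k, j = k + 1 := ⟨j - 1, by omega⟩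
  have hmap := reesPhi_map (R := R) x (k + 1)
  have hmem : ∀ a ∈ reesPower R E (k + 1), (reesPhi (R := R) x).toLinearMap a ∈
      reesPower R (E ⧸ Submodule.span R {x}) (k + 1) := by
    intro a ha
    rw [← hmap]
    exact Submodule.mem_map_of_mem ha
  let ψ := (reesPhi (R := R) x).toLinearMap.restrict hmem
  have hsurj : Function.Surjective ψ := by
    rintro ⟨b, hb⟩
    rw [← hmap] at hb
    obtain ⟨a, ha, rfl⟩ := hb
    exact ⟨⟨a, ha⟩, rfl⟩
  have hker : Submodule.comap (reesPower R E (k + 1)).subtype (xMulPow R E x (k + 1 - 1)) =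
      LinearMap.ker ψ := by
    apply le_antisymm
    · rintro ⟨a, ha⟩ h
      have hle : xMulPow R E x (k + 1 - 1) ≤ LinearMap.ker (reesPhi (R := R) x).toLinearMap := by
        unfold xMulPow
        rw [Submodule.span_le]
        rintro _ ⟨c, _, rfl⟩
        change reesPhi (R := R) x _ = 0
        rw [map_mul, reesPhi_ι_self, zero_mul]
      exact Subtype.ext (hle h)
    · rintro ⟨a, ha⟩ h
      have h0 : reesPhi (R := R) x a = 0 := congrArg Subtype.val h
      obtain ⟨r, hr, h1⟩ := reesPhi_ker x a h0
      have h2 := mem_xMulPow (Submodule.smul_mem _ r ha) h1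
      rw [← Submodule.Quotient.mk_eq_zero]
      have h3 : (Submodule.Quotient.mk ⟨a, ha⟩ : xQuot R E x (k + 1)) ∈
          Submodule.torsion R (xQuot R E x (k + 1)) := by
        refine ⟨⟨r, hr⟩, ?_⟩
        change (Submodule.Quotient.mk (r • ⟨a, ha⟩) : xQuot R E x (k + 1)) = 0
        rw [Submodule.Quotient.mk_eq_zero]
        exact h2
      rw [htf _ hj hjs] at h3
      exact h3
  exact ⟨(Submodule.quotEquivOfEq _ _ hker).trans (ψ.quotKerEquivOfSurjective hsurj)⟩
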